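/- Let (X,𝓑,μ,T,d) be an exponentially mixing metric measure-preserving system on a compact metric space with μ Ahlfors s-regular, and let (l_n)_{n≥0} be positive reals decreasing to 0. Then for μ-almost every x ∈ X, the dynamical covering set E(x,l_n) = limsup_{n→∞} B(T^n x, l_n) is dense in X. -/

import Mathlib

open MeasureTheory Metric Filter

/-- A Borel (probability) measure `μ` on a metric space is *Ahlfors `s`-regular* if there is a
constant `0 < C < ∞` with `C⁻¹ r^s ≤ μ (B(x,r)) ≤ C r^s` for all `x` and `0 < r ≤ diam X`. -/
def IsAhlforsRegular {X : Type*} [MetricSpace X] [MeasurableSpace X]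
    (μ : Measure X) (s : ℝ) : Prop :=
  ∃ C : ℝ, 0 < C ∧ ∀ (x : X) (r : ℝ), 0 < r → r ≤ diam (Set.univ : Set X) →
    ENNReal.ofReal (C⁻¹ * r ^ s) ≤ μ (ball x r) ∧ μ (ball x r) ≤ ENNReal.ofReal (C * r ^ s)

/-- A metric measure-preserving system `(X, μ, T)` is *exponentially mixing* (with constants
`c > 0`, `0 < γ < 1`) if `|μ(A ∩ T⁻ⁿF)/μ(F) - μ(A)| ≤ c γ^n` for every `n ≥ 1`, every ball
`A = B(y,ρ)` and every measurable `F` with `μ F > 0`. -/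
def IsExpMixingSystem {X : Type*} [MetricSpace X] [MeasurableSpace X]
    (μ : Measure X) (T : X → X) (c γ : ℝ) : Prop :=
  ∀ n : ℕ, 1 ≤ n → ∀ (y : X) (ρ : ℝ) (F : Set X), MeasurableSet F → 0 < μ F →
    |(μ (ball y ρ ∩ T^[n] ⁻¹' F)).toReal / (μ F).toReal - (μ (ball y ρ)).toReal| ≤ c * γ ^ n

theorem ahlfors_ball_pos {X : Type*} [MetricSpace X] [CompactSpace X] [MeasurableSpace X]
    (μ : Measure X) [IsProbabilityMeasure μ] (s : ℝ) (hreg : IsAhlforsRegular μ s)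
    (y : X) (r : ℝ) (hr : 0 < r) : 0 < μ (ball y r) := by
  obtain ⟨C, hC, h⟩ := hreg
  have hb : Bornology.IsBounded (Set.univ : Set X) := isCompact_univ.isBounded
  rcases (diam_nonneg (s := (Set.univ : Set X))).eq_or_lt with hd | hd
  · have : ball y r = Set.univ := by
      ext z
      have := dist_le_diam_of_mem hb (Set.mem_univ z) (Set.mem_univ y)
      simp only [mem_ball, Set.mem_univ, iff_true]
      linarith
    rw [this]; simp
  · have h1 := (h y (min r (diam Set.univ)) (lt_min hr hd) (min_le_right _ _)).1
    have h2 : 0 < ENNReal.ofReal (C⁻¹ * (min r (diam (Set.univ : Set X))) ^ s) := by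
      have := Real.rpow_pos_of_pos (lt_min hr hd) s
      rw [ENNReal.ofReal_pos]; positivity
    exact (h2.trans_le h1).trans_le (measure_mono (ball_subset_ball (min_le_left _ _)))

theorem visits_io {X : Type*} [MetricSpace X] [CompactSpace X] [MeasurableSpace X] [BorelSpace X]
    (μ : Measure X) [IsProbabilityMeasure μ] (s : ℝ) (hreg : IsAhlforsRegular μ s)
    (T : X → X) (hT : Measurable T) (hpres : MeasurePreserving T μ μ)
    (c γ : ℝ) (hγ0 : 0 < γ) (hγ1 : γ < 1) (hmix : IsExpMixingSystem μ T c γ)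
    (V : Set X) (hV : IsOpen V) (hne : V.Nonempty) (N : ℕ) :
    ∀ᵐ x ∂μ, ∃ n, N ≤ n ∧ T^[n] x ∈ V := by
  set F : Set X := {x | ∀ n, T^[n] x ∉ V} with hF
  have hFm : MeasurableSet F := by
    have : F = ⋂ n, (T^[n] ⁻¹' V)ᶜ := by ext; simp [hF]
    rw [this]
    exact MeasurableSet.iInter fun n => ((hT.iterate n) hV.measurableSet).compl
  have hsub : ∀ n, F ⊆ T^[n] ⁻¹' F := by
    intro n x hx m
    rw [← Function.iterate_add_apply]
    exact hx _
  have hF0 : μ F = 0 := by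
    by_contra hne0
    obtain ⟨y, hy⟩ := hne
    obtain ⟨r, hr, hrV⟩ := Metric.isOpen_iff.1 hV y hy
    have hp := ahlfors_ball_pos μ s hreg y r hr
    have hz : ∀ n, μ (ball y r ∩ T^[n] ⁻¹' F) = 0 := by
      intro n
      have h1 : μ (T^[n] ⁻¹' F \ F) = 0 := by
        rw [measure_sdiff (hsub n) hFm.nullMeasurableSet (measure_ne_top _ _),
          (hpres.iterate n).measure_preimage hFm.nullMeasurableSet, tsub_self]
      refine measure_mono_null ?_ h1
      rintro x ⟨hx1, hx2⟩
      exact ⟨hx2, fun hx => hx 0 (hrV hx1)⟩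
    have hle : ∀ n : ℕ, 1 ≤ n → (μ (ball y r)).toReal ≤ c * γ ^ n := by
      intro n hn
      have := hmix n hn y r F hFm (pos_iff_ne_zero.2 hne0)
      rw [hz n] at this
      simpa using this
    have hlim : Tendsto (fun n : ℕ => c * γ ^ n) atTop (nhds (c * 0)) :=
      (tendsto_pow_atTop_nhds_zero_of_lt_one hγ0.le hγ1).const_mul c
    have := ge_of_tendsto hlim (eventually_atTop.2 ⟨1, hle⟩)
    have h3 := ENNReal.toReal_pos hp.ne' (measure_ne_top _ _)
    linarith
  have hN : μ (T^[N] ⁻¹' F) = 0 := by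
    rw [(hpres.iterate N).measure_preimage hFm.nullMeasurableSet, hF0]
  rw [ae_iff]
  refine measure_mono_null ?_ hN
  intro x hx n
  rw [← Function.iterate_add_apply]
  exact fun h => hx ⟨n + N, Nat.le_add_left _ _, h⟩

/-- dynamical Theorem 3. For an exponentially mixing metric
measure-preserving system `(X, μ, T)` with `μ` Ahlfors `s`-regular and `(l n)` decreasing to
`0`, for `μ`-a.e. `x` the dynamical covering set `E(x) = limsup B(T^n x, l n)` is dense. -/
theorem dynamical_covering_dense
    {X : Type*} [MetricSpace X] [CompactSpace X] [MeasurableSpace X] [BorelSpace X]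
    (μ : Measure X) [IsProbabilityMeasure μ]
    (s : ℝ) (hs : 0 < s) (hreg : IsAhlforsRegular μ s)
    (T : X → X) (hT : Measurable T) (hpres : MeasurePreserving T μ μ)
    (c γ : ℝ) (hc : 0 < c) (hγ0 : 0 < γ) (hγ1 : γ < 1)
    (hmix : IsExpMixingSystem μ T c γ)
    (l : ℕ → ℝ) (hpos : ∀ n, 0 < l n) (hanti : Antitone l)
    (hlim : Tendsto l atTop (nhds 0)) :
    ∀ᵐ x ∂μ, Dense (Filter.limsup (fun n => ball (T^[n] x) (l n)) atTop) := by
  have key : ∀ᵐ x ∂μ, ∀ V ∈ TopologicalSpace.countableBasis X, ∀ N : ℕ,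
      ∃ n, N ≤ n ∧ T^[n] x ∈ V := by
    rw [ae_ball_iff (TopologicalSpace.countable_countableBasis X)]
    intro V hV
    rw [ae_all_iff]
    intro N
    exact visits_io μ s hreg T hT hpres c γ hγ0 hγ1 hmix V
      (TopologicalSpace.isOpen_of_mem_countableBasis hV)
      (TopologicalSpace.nonempty_of_mem_countableBasis hV) N
  filter_upwards [key] with x hx
  rw [Filter.limsup_eq_iInf_iSup_of_nat]
  simp only [Set.iInf_eq_iInter, Set.iSup_eq_iUnion]
  refine dense_iInter_of_isOpen
    (fun N => isOpen_iUnion fun n => isOpen_iUnion fun _ => isOpen_ball) ?_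
  intro N
  rw [(TopologicalSpace.isBasis_countableBasis X).dense_iff]
  intro V hV _
  obtain ⟨n, hn, hnV⟩ := hx V hV N
  exact ⟨T^[n] x, hnV, Set.mem_iUnion₂.2 ⟨n, hn, mem_ball_self (hpos n)⟩⟩
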